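/- The only integer solutions (t, y) of -y^2 = t^3 + 2t^2 + t + 1 are (t, y) = (-2, 1) and (t, y) = (-2, -1). -/

import Mathlib

open NumberField in
/-- a multiplicative relation among sufficiently many units, with some odd exponent -/
theorem unit_relation {R : Type*} [CommRing R] (K : Type*) [Field K] [NumberField K]
    (f : R →+* 𝓞 K) (hf : Function.Injective f) (τ : K →+* ℝ) (n : ℕ)
    (hn : NumberField.Units.rank K < n) (g : Fin n → Rˣ) :
    ∃ c : Fin n → ℤ, (∃ i, Odd (c i)) ∧ ((∏ i, g i ^ c i = 1) ∨ (∏ i, g i ^ c i = -1)) := by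
  classical
  -- the real embedding
  let ψ : R →+* ℝ := τ.comp ((algebraMap (𝓞 K) K).comp f)
  have hψ : Function.Injective ψ :=
    τ.injective.comp ((RingOfIntegers.coe_injective (K := K)).comp hf)
  have key : ∀ (x : Rˣ) (m : ℕ), m ≠ 0 → x ^ m = 1 → x = 1 ∨ x = -1 := by
    intro x m hm hx
    have h1 : (ψ x) ^ m = 1 := by
      rw [← map_pow, ← Units.val_pow_eq_pow_val, hx, Units.val_one, map_one]
    have h2 : |ψ x| = 1 := by
      have : |ψ x| ^ m = 1 := by rw [← abs_pow, h1, abs_one]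
      exact (pow_eq_one_iff_of_nonneg (abs_nonneg _) hm).1 this
    rcases eq_or_eq_neg_of_abs_eq h2 with h | h
    · left; ext; apply hψ; rw [h, Units.val_one, map_one]
    · right; ext; apply hψ; rw [h, Units.val_neg, Units.val_one, map_neg, map_one]
  have keyz : ∀ (x : Rˣ) (m : ℤ), m ≠ 0 → x ^ m = 1 → x = 1 ∨ x = -1 := by
    intro x m hm hx
    apply key x m.natAbs (by omega)
    rcases Int.natAbs_eq m with h | h
    · rw [h] at hx; simpa using hx
    · rw [h] at hx; simpa using hx
  -- linear dependence
  let v : Fin n → Additive (𝓞 K)ˣ := fun i =>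
    Additive.ofMul (_root_.Units.map f.toMonoidHom (g i))
  have hdep : ¬ LinearIndependent ℤ v := by
    intro h
    have := h.fintype_card_le_finrank
    rw [Units.finrank_eq, Fintype.card_fin] at this
    omega
  rw [Fintype.not_linearIndependent_iff] at hdep
  obtain ⟨a, ha, i, hi⟩ := hdep
  have hx : ∏ i, g i ^ a i = 1 := by
    have h2 : Additive.ofMul (_root_.Units.map f.toMonoidHom (∏ i, g i ^ a i))
        = ∑ i, a i • v i := by
      rw [map_prod, ofMul_prod]
      refine Finset.sum_congr rfl fun i _ => ?_
      rw [map_zpow, ofMul_zpow]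
    rw [ha] at h2
    have h3 : _root_.Units.map f.toMonoidHom (∏ i, g i ^ a i) = 1 := h2
    apply _root_.Units.map_injective (f := f.toMonoidHom) hf
    rw [h3, map_one]
  -- extract the gcd
  obtain ⟨c, hc, hcg⟩ := Finset.extract_gcd a (s := Finset.univ) ⟨i, Finset.mem_univ i⟩
  set d := Finset.univ.gcd a with hd
  have hd0 : d ≠ 0 := by
    intro h0
    have := hc i (Finset.mem_univ i)
    rw [h0, zero_mul] at this
    exact hi this
  refine ⟨c, ?_, ?_⟩
  · by_contra hcon
    push Not at hcon
    have h2 : (2 : ℤ) ∣ Finset.univ.gcd c := Finset.dvd_gcd fun j _ =>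
      even_iff_two_dvd.1 (Int.not_odd_iff_even.1 (hcon j))
    rw [hcg] at h2
    norm_num at h2
  · apply keyz _ d hd0
    rw [← Finset.prod_zpow, ← hx]
    refine Finset.prod_congr rfl fun j hj => ?_
    rw [hc j hj, ← zpow_mul, mul_comm]

open NumberField in
theorem rank_le_of_complex (K : Type*) [Field K] [NumberField K] (φ : K →+* ℂ)
    (x : K) (hx : (φ x).im ≠ 0) : 1 ≤ InfinitePlace.nrComplexPlaces K ∧
      NumberField.Units.rank K + 2 ≤ Module.finrank ℚ K := by
  classical
  have h1 : 1 ≤ InfinitePlace.nrComplexPlaces K := by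
    rw [InfinitePlace.nrComplexPlaces, Nat.succ_le_iff, Fintype.card_pos_iff]
    refine ⟨⟨InfinitePlace.mk φ, ?_⟩⟩
    rw [InfinitePlace.isComplex_mk_iff]
    intro h
    apply hx
    have := RingHom.congr_fun h x
    exact Complex.conj_eq_iff_im.1 this
  refine ⟨h1, ?_⟩
  have h2 := InfinitePlace.card_add_two_mul_card_eq_rank K
  have h3 := InfinitePlace.card_eq_nrRealPlaces_add_nrComplexPlaces K
  have h4 : NumberField.Units.rank K = Fintype.card (InfinitePlace K) - 1 := by
    rw [Units.rank]
  omega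

@[ext] structure Q4 (R : Type*) where
  a : R
  b : R
  c : R
  d : R
deriving DecidableEq

namespace Q4

variable {R S : Type*} [CommRing R] [CommRing S]

/-- multiplication in `R[π]` with `π^4 = 2π^3 - 2π^2 + 2`. -/
instance : Mul (Q4 R) := ⟨fun x y =>
  let r4 := x.b * y.d + x.c * y.c + x.d * y.b
  let r5 := x.c * y.d + x.d * y.c
  let r6 := x.d * y.d
  ⟨x.a * y.a + 2 * r4 + 4 * r5 + 4 * r6,
   x.a * y.b + x.b * y.a + 2 * r5 + 4 * r6,
   x.a * y.c + x.b * y.b + x.c * y.a - 2 * r4 - 4 * r5 - 2 * r6,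
   x.a * y.d + x.b * y.c + x.c * y.b + x.d * y.a + 2 * r4 + 2 * r5⟩⟩
instance : Add (Q4 R) := ⟨fun x y => ⟨x.a + y.a, x.b + y.b, x.c + y.c, x.d + y.d⟩⟩
instance : Neg (Q4 R) := ⟨fun x => ⟨-x.a, -x.b, -x.c, -x.d⟩⟩
instance : Zero (Q4 R) := ⟨⟨0, 0, 0, 0⟩⟩
instance : One (Q4 R) := ⟨⟨1, 0, 0, 0⟩⟩

theorem mul_def (x y : Q4 R) : x * y =
  ⟨x.a * y.a + 2 * (x.b * y.d + x.c * y.c + x.d * y.b) + 4 * (x.c * y.d + x.d * y.c)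
      + 4 * (x.d * y.d),
   x.a * y.b + x.b * y.a + 2 * (x.c * y.d + x.d * y.c) + 4 * (x.d * y.d),
   x.a * y.c + x.b * y.b + x.c * y.a - 2 * (x.b * y.d + x.c * y.c + x.d * y.b)
      - 4 * (x.c * y.d + x.d * y.c) - 2 * (x.d * y.d),
   x.a * y.d + x.b * y.c + x.c * y.b + x.d * y.a + 2 * (x.b * y.d + x.c * y.c + x.d * y.b)
      + 2 * (x.c * y.d + x.d * y.c)⟩ := rfl
theorem add_def (x y : Q4 R) : x + y = ⟨x.a + y.a, x.b + y.b, x.c + y.c, x.d + y.d⟩ := rfl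
theorem neg_def (x : Q4 R) : -x = ⟨-x.a, -x.b, -x.c, -x.d⟩ := rfl
theorem zero_def : (0 : Q4 R) = ⟨0, 0, 0, 0⟩ := rfl
theorem one_def : (1 : Q4 R) = ⟨1, 0, 0, 0⟩ := rfl

instance : CommRing (Q4 R) where
  add_assoc x y z := by ext <;> simp only [add_def] <;> ring
  zero_add x := by ext <;> simp only [add_def, zero_def] <;> ring
  add_zero x := by ext <;> simp only [add_def, zero_def] <;> ring
  add_comm x y := by ext <;> simp only [add_def] <;> ring
  left_distrib x y z := by ext <;> simp only [add_def, mul_def] <;> ring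
  right_distrib x y z := by ext <;> simp only [add_def, mul_def] <;> ring
  zero_mul x := by ext <;> simp only [zero_def, mul_def] <;> ring
  mul_zero x := by ext <;> simp only [zero_def, mul_def] <;> ring
  mul_assoc x y z := by ext <;> simp only [mul_def] <;> ring
  one_mul x := by ext <;> simp only [one_def, mul_def] <;> ring
  mul_one x := by ext <;> simp only [one_def, mul_def] <;> ring
  mul_comm x y := by ext <;> simp only [mul_def] <;> ring
  neg_add_cancel x := by ext <;> simp only [zero_def, neg_def, add_def] <;> ring
  nsmul := nsmulRec
  zsmul := zsmulRec

/-- change of coefficients -/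
def map (f : R →+* S) : Q4 R →+* Q4 S where
  toFun x := ⟨f x.a, f x.b, f x.c, f x.d⟩
  map_one' := by simp [one_def]
  map_zero' := by simp [zero_def]
  map_add' x y := by simp [add_def]
  map_mul' x y := by simp [mul_def, map_ofNat f 2, map_ofNat f 4]

/-- scalars -/
def C : R →+* Q4 R where
  toFun x := ⟨x, 0, 0, 0⟩
  map_one' := rfl
  map_zero' := rfl
  map_add' x y := by simp [add_def]
  map_mul' x y := by simp [mul_def]

theorem C_mul (r : R) (x : Q4 R) : C r * x = ⟨r * x.a, r * x.b, r * x.c, r * x.d⟩ := by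
  ext <;> simp [C, mul_def]

theorem two_pow_mul (e : ℕ) (x : Q4 R) :
    (2 : Q4 R) ^ e * x = ⟨2 ^ e * x.a, 2 ^ e * x.b, 2 ^ e * x.c, 2 ^ e * x.d⟩ := by
  have : (2 : Q4 R) ^ e = C (2 ^ e) := by rw [map_pow, map_ofNat C 2]
  rw [this, C_mul]

def e1 : Q4 R := ⟨1, -1, 0, 0⟩
def e2 : Q4 R := ⟨1, 0, -1, 1⟩

theorem map_e1 (f : R →+* S) : map f e1 = e1 := by ext <;> simp [map, e1]
theorem map_e2 (f : R →+* S) : map f e2 = e2 := by ext <;> simp [map, e2]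


theorem check16 : ∀ a : Fin 32, ∀ b : Fin 16, ∀ x : Q4 (ZMod 16), x = e1 ^ a.1 * e2 ^ b.1 →
    x.b + 2 * x.c = 0 → x.c + x.d = 0 → 8 * x.c = 0 →
    (a.1 % 16 = 0 ∧ b.1 % 8 = 0) ∨ (a.1 % 16 = 8 ∧ b.1 % 8 = 4) := by
  simp only [forall_eq]
  decide +kernel

theorem check256 : ∀ a : Fin 32, ∀ b : Fin 32, ∀ x : Q4 (ZMod 256),
    x = (e1 ^ 16) ^ a.1 * (e2 ^ 8) ^ b.1 →
    x.b + 2 * x.c = 0 → x.c + x.d = 0 →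
    (a.1 % 4 = 0 ∧ b.1 % 4 = 0) := by
  have h1 : (e1 ^ 16 : Q4 (ZMod 256)) = ⟨49, 112, 224, 40⟩ := by decide +kernel
  have h2 : (e2 ^ 8 : Q4 (ZMod 256)) = ⟨113, 128, 136, 48⟩ := by decide +kernel
  simp only [forall_eq, h1, h2]
  decide +kernel

/-- the element `s - 2kα` -/
def U (s k : R) : Q4 R := ⟨s, -4 * k, 2 * k, -2 * k⟩

theorem check7 : ∀ s k : ZMod 7, s ^ 4 - 32 * s ^ 2 * k ^ 2 - 64 * s * k ^ 3 - 64 * k ^ 4 = 1 →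
    (U s k) ^ 75 ≠ e1 ^ 600 * e2 ^ 300 ∧ (U s k) ^ 75 ≠ -(e1 ^ 600 * e2 ^ 300) := by
  have h1 : (e1 ^ 600 * e2 ^ 300 : Q4 (ZMod 7)) = ⟨4, 5, 3, 3⟩ := by decide +kernel
  rw [h1]
  decide +kernel

theorem map_U (f : R →+* S) (s k : R) : map f (U s k) = U (f s) (f k) := by
  ext <;> simp [map, U, map_ofNat f 2, map_ofNat f 4]

theorem pi7 : (⟨0, 1, 0, 0⟩ : Q4 (ZMod 7)) ^ 2401 = ⟨0, 1, 0, 0⟩ := by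
  have h1 : (⟨0, 1, 0, 0⟩ : Q4 (ZMod 7)) ^ 49 = ⟨2, 2, 6, 6⟩ := by decide +kernel
  have h2 : (⟨2, 2, 6, 6⟩ : Q4 (ZMod 7)) ^ 49 = ⟨0, 1, 0, 0⟩ := by decide +kernel
  rw [show 2401 = 49 * 49 by norm_num, pow_mul, h1, h2]

theorem frob7 (w : Q4 (ZMod 7)) : w ^ 2401 = w := by
  have : CharP (Q4 (ZMod 7)) 7 :=
    charP_of_injective_ringHom (f := (C : ZMod 7 →+* Q4 (ZMod 7)))
      (fun x y h => by simpa [C] using congrArg Q4.a h) 7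
  have : Fact (Nat.Prime 7) := ⟨by norm_num⟩
  have hw : w = C w.a + C w.b * ⟨0, 1, 0, 0⟩ + C w.c * ⟨0, 1, 0, 0⟩ ^ 2
      + C w.d * ⟨0, 1, 0, 0⟩ ^ 3 := by
    ext <;> simp [C, mul_def, add_def, pow_succ, one_def]
  have hc : ∀ c : ZMod 7, c ^ 2401 = c := by
    intro c
    have := ZMod.pow_card c
    calc c ^ 2401 = (((c ^ 7) ^ 7) ^ 7) ^ 7 := by ring
      _ = c := by rw [this, this, this, this]
  have h4 : (2401 : ℕ) = 7 ^ 4 := by norm_num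
  have hadd : ∀ x y : Q4 (ZMod 7), (x + y) ^ 2401 = x ^ 2401 + y ^ 2401 := by
    intro x y
    rw [h4]; exact add_pow_char_pow x y 7 4
  conv_lhs => rw [hw]
  rw [hadd, hadd, hadd, mul_pow, mul_pow, mul_pow, pow_right_comm _ 2, pow_right_comm _ 3, pi7,
    ← map_pow, ← map_pow, ← map_pow, ← map_pow, hc, hc, hc, hc]
  exact hw.symm

theorem unit7 (w : (Q4 ℤ)ˣ) : (map (Int.castRingHom (ZMod 7)) w) ^ 2400 = 1 := by
  have h := frob7 (map (Int.castRingHom (ZMod 7)) w)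
  have hu : IsUnit (map (Int.castRingHom (ZMod 7)) (w : Q4 ℤ)) := w.isUnit.map _
  apply hu.mul_right_cancel
  rw [one_mul, ← pow_succ, h]

/-- reduction modulo `π` -/
def red : Q4 ℤ →+* ZMod 2 where
  toFun x := (x.a : ZMod 2)
  map_one' := by simp [one_def]
  map_zero' := by simp [zero_def]
  map_add' x y := by simp [add_def]
  map_mul' x y := by
    have h2 : (2 : ZMod 2) = 0 := rfl
    have h4 : (4 : ZMod 2) = 0 := rfl
    simp [mul_def, h2, h4]

theorem unit_odd (w : (Q4 ℤ)ˣ) : ∃ m, (w : Q4 ℤ).a = 2 * m + 1 := by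
  have hu : IsUnit (red (w : Q4 ℤ)) := w.isUnit.map _
  have h1 : red (w : Q4 ℤ) ≠ 0 := hu.ne_zero
  have h2 : ¬ (2 ∣ (w : Q4 ℤ).a) := by
    intro h
    apply h1
    exact (ZMod.intCast_zmod_eq_zero_iff_dvd _ 2).2 h
  exact ⟨(w : Q4 ℤ).a / 2, by omega⟩

theorem unit_pow4 (w : (Q4 ℤ)ˣ) : ∃ z : Q4 ℤ, (w : Q4 ℤ) ^ 4 = 1 + 2 * z := by
  obtain ⟨m, hm⟩ := unit_odd w
  have h2 : (2 : Q4 ℤ) = ⟨2, 0, 0, 0⟩ := rfl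
  generalize (w : Q4 ℤ) = v at hm ⊢
  obtain ⟨a, b, c, d⟩ := v
  simp only at hm
  subst hm
  have key : ∀ p : Q4 ℤ, ∀ q : Q4 ℤ, ∀ r : Q4 ℤ, p ^ 4 = 2 * r →
      ∃ z, (1 + 2 * (C m) + p * q) ^ 4 = 1 + 2 * z := by
    intro p q r h
    refine ⟨r * q ^ 4 + 2 * (p * q) ^ 3 * (1 + 2 * C m) + 3 * (p * q) ^ 2 * (1 + 2 * C m) ^ 2
      + 2 * (p * q) * (1 + 2 * C m) ^ 3 + (4 * C m + 12 * (C m) ^ 2 + 16 * (C m) ^ 3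
      + 8 * (C m) ^ 4), ?_⟩
    linear_combination q ^ 4 * h
  obtain ⟨z, hz⟩ := key ⟨0, 1, 0, 0⟩ ⟨b, c, d, 0⟩ ⟨1, 0, -1, 1⟩ (by
    rw [h2]; ext <;> simp [mul_def, pow_succ, one_def])
  refine ⟨z, ?_⟩
  rw [← hz]
  congr 1
  have hC : C m = ⟨m, 0, 0, 0⟩ := rfl
  rw [h2, hC]
  ext <;> simp [mul_def, add_def, one_def]
  ring

theorem pow_two_pow (x z : Q4 ℤ) (h : x = 1 + 2 * z) (n : ℕ) :
    ∃ y, x ^ (2 ^ n) = 1 + 2 ^ (n + 1) * y := by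
  induction n with
  | zero => exact ⟨z, by simpa using h⟩
  | succ n ih =>
    obtain ⟨y, hy⟩ := ih
    refine ⟨y + 2 ^ n * y ^ 2, ?_⟩
    rw [pow_succ 2 n, pow_mul, hy]; ring

theorem unit_pow (w : (Q4 ℤ)ˣ) (n : ℕ) :
    ∃ y : Q4 ℤ, (w : Q4 ℤ) ^ (2 ^ (n + 2)) = 1 + 2 ^ (n + 1) * y := by
  obtain ⟨z, hz⟩ := unit_pow4 w
  obtain ⟨y, hy⟩ := pow_two_pow _ z hz n
  refine ⟨y, ?_⟩
  rw [← hy, ← pow_mul]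
  congr 1
  ring

theorem powform (x0 : Q4 ℤ) (v : ℕ) :
    ∃ z, (1 + 32 * x0) ^ (2 ^ v) = 1 + 2 ^ (5 + v) * (x0 + 16 * z) := by
  induction v with
  | zero => exact ⟨0, by norm_num⟩
  | succ v ih =>
    obtain ⟨z, hz⟩ := ih
    refine ⟨z + 2 ^ v * (x0 + 16 * z) ^ 2, ?_⟩
    rw [pow_succ 2 v, pow_mul, hz]; ring

theorem powA (x : Q4 ℤ) (e A : ℕ) :
    ∃ z, (1 + 2 ^ e * x) ^ A = 1 + 2 ^ e * (A * x + 2 ^ e * z) := by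
  induction A with
  | zero => exact ⟨0, by simp⟩
  | succ A ih =>
    obtain ⟨z, hz⟩ := ih
    refine ⟨z + (A * x + 2 ^ e * z) * x, ?_⟩
    rw [pow_succ, hz]; push_cast; ring

def x0 : Q4 ℤ := ⟨10880071040646, -15259891273122, 10522754811764, -3878663125483⟩
def y0 : Q4 ℤ := ⟨956406582, 551418832, -1051343831, 79475358⟩

theorem e1_64 : (e1 : Q4 ℤ) ^ 64 = 1 + 32 * x0 := by decide +kernel
theorem e2_32 : (e2 : Q4 ℤ) ^ 32 = 1 + 32 * y0 := by decide +kernel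

theorem prodform (A B v : ℕ) :
    ∃ z : Q4 ℤ, (e1 ^ 64) ^ (2 ^ v * A) * (e2 ^ 32) ^ (2 ^ v * B) =
      1 + 2 ^ (5 + v) * ((A : Q4 ℤ) * x0 + (B : Q4 ℤ) * y0 + 16 * z) := by
  obtain ⟨z1, h1⟩ := powform x0 v
  obtain ⟨z2, h2⟩ := powform y0 v
  obtain ⟨z3, h3⟩ := powA (x0 + 16 * z1) (5 + v) A
  obtain ⟨z4, h4⟩ := powA (y0 + 16 * z2) (5 + v) B
  rw [pow_mul, pow_mul, e1_64, e2_32, h1, h2, h3, h4]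
  refine ⟨(A : Q4 ℤ) * z1 + (B : Q4 ℤ) * z2 + 2 * 2 ^ v * z3 + 2 * 2 ^ v * z4 +
    2 * 2 ^ v * (((A : Q4 ℤ) * (x0 + 16 * z1) + 2 ^ (5 + v) * z3) *
      ((B : Q4 ℤ) * (y0 + 16 * z2) + 2 ^ (5 + v) * z4)), ?_⟩
  ring

theorem natCast_mul_def (n : ℕ) (x : Q4 ℤ) :
    (n : Q4 ℤ) * x = ⟨n * x.a, n * x.b, n * x.c, n * x.d⟩ := by
  have : (n : Q4 ℤ) = C (n : ℤ) := by simp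
  rw [this, C_mul]

theorem sixteen_mul_def (x : Q4 ℤ) :
    (16 : Q4 ℤ) * x = ⟨16 * x.a, 16 * x.b, 16 * x.c, 16 * x.d⟩ := by
  have := natCast_mul_def 16 x
  exact_mod_cast this

/-- one step of the 2-adic descent -/
theorem step (A B v M : ℕ) (s k σ : ℤ) (y : Q4 ℤ) (hσ : σ = 1 ∨ σ = -1) (hv : v + 9 ≤ M)
    (h : (e1 ^ 64) ^ (2 ^ v * A) * (e2 ^ 32) ^ (2 ^ v * B) = C σ * (U s k) + 2 ^ M * y) :
    2 ∣ A ∧ 2 ∣ B := by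
  obtain ⟨z, hz⟩ := prodform A B v
  rw [hz] at h
  obtain ⟨j, rfl⟩ := Nat.exists_eq_add_of_le hv
  rw [show v + 9 + j = (5 + v) + (4 + j) by ring, pow_add, mul_assoc] at h
  simp only [two_pow_mul, natCast_mul_def, sixteen_mul_def, C_mul, add_def, one_def, U] at h
  have hb := congrArg Q4.b h
  have hc := congrArg Q4.c h
  have hd := congrArg Q4.d h
  simp only [x0, y0] at hb hc hd
  have hp : (2 : ℤ) ^ (5 + v) ≠ 0 := by positivity
  have t1 : (A * (-15259891273122) + B * 551418832 + 16 * z.b)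
      + 2 * (A * 10522754811764 + B * (-1051343831) + 16 * z.c)
      = 16 * (2 ^ j * y.b + 2 * (2 ^ j * y.c)) := by
    apply mul_left_cancel₀ hp
    linear_combination hb + 2 * hc
  have t2 : (A * 10522754811764 + B * (-1051343831) + 16 * z.c)
      + (A * (-3878663125483) + B * 79475358 + 16 * z.d)
      = 16 * (2 ^ j * y.c + (2 ^ j * y.d)) := by
    apply mul_left_cancel₀ hp
    linear_combination hc + hd
  generalize (2 ^ j * y.b + 2 * (2 ^ j * y.c)) = P at t1
  generalize (2 ^ j * y.c + (2 ^ j * y.d)) = Q at t2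
  have hA : (A : ℤ) * (585489033127499471399) = 2 * ((-971868473) * (P - z.b - 2 * z.c)
      - (-1551268830) * (Q - z.c - z.d)) := by
    apply mul_left_cancel₀ (show (8 : ℤ) ≠ 0 by norm_num)
    linear_combination (-971868473) * t1 - (-1551268830) * t2
  have hB : (B : ℤ) * (585489033127499471399) = 2 * ((5785618350406) * (Q - z.c - z.d)
      - (6644091686281) * (P - z.b - 2 * z.c)) := by
    apply mul_left_cancel₀ (show (8 : ℤ) ≠ 0 by norm_num)
    linear_combination (5785618350406) * t2 - (6644091686281) * t1
  have ho : IsCoprime (2 : ℤ) (585489033127499471399) := by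
    rw [Int.isCoprime_iff_gcd_eq_one]; norm_num
  constructor
  · exact_mod_cast ho.dvd_of_dvd_mul_right (Dvd.intro _ hA.symm)
  · exact_mod_cast ho.dvd_of_dvd_mul_right (Dvd.intro _ hB.symm)

theorem descent (A B M : ℕ) (s k σ : ℤ) (y : Q4 ℤ) (hσ : σ = 1 ∨ σ = -1)
    (h : (e1 ^ 64) ^ A * (e2 ^ 32) ^ B = C σ * (U s k) + 2 ^ M * y) (v : ℕ) (hv : v + 8 ≤ M) :
    2 ^ v ∣ A ∧ 2 ^ v ∣ B := by
  induction v with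
  | zero => simp
  | succ v ih =>
    obtain ⟨⟨A', hA⟩, ⟨B', hB⟩⟩ := ih (by omega)
    have := step A' B' v M s k σ y hσ (by omega) (by rw [← hA, ← hB]; exact h)
    rw [hA, hB, pow_succ]
    exact ⟨mul_dvd_mul_left _ this.1, mul_dvd_mul_left _ this.2⟩

theorem descent_end (A B M : ℕ) (s k σ : ℤ) (y : Q4 ℤ) (hσ : σ = 1 ∨ σ = -1)
    (h : (e1 ^ 64) ^ A * (e2 ^ 32) ^ B = C σ * (U s k) + 2 ^ (M + 8) * y) :
    (2 : ℤ) ^ M ∣ k := by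
  obtain ⟨⟨A', hA⟩, ⟨B', hB⟩⟩ := descent A B (M + 8) s k σ y hσ h M (by omega)
  obtain ⟨z, hz⟩ := prodform A' B' M
  rw [← hA, ← hB, h] at hz
  generalize (A' : Q4 ℤ) * x0 + (B' : Q4 ℤ) * y0 + 16 * z = W at hz
  rw [two_pow_mul, two_pow_mul] at hz
  have hc := congrArg Q4.c hz
  simp only [C_mul, add_def, one_def, U, pow_add] at hc
  have h2 : ∃ q : ℤ, 2 * k = 2 ^ M * (2 * q) := by
    rcases hσ with rfl | rfl
    · exact ⟨2 ^ 4 * W.c - 2 ^ 7 * y.c, by linear_combination hc⟩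
    · exact ⟨-(2 ^ 4 * W.c - 2 ^ 7 * y.c), by linear_combination -hc⟩
  obtain ⟨q, hq⟩ := h2
  exact ⟨q, by linarith⟩

/-- the unit `s - 2kα` when the quartic form takes the value `1` -/
def uU (s k : ℤ) (h : s ^ 4 - 32 * s ^ 2 * k ^ 2 - 64 * s * k ^ 3 - 64 * k ^ 4 = 1) :
    (Q4 ℤ)ˣ :=
  Units.mkOfMulEqOne (U s k)
    (C (s ^ 3) + C (2 * s ^ 2 * k) * ⟨0, 2, -1, 1⟩ + C (4 * s * k ^ 2) * (⟨0, 2, -1, 1⟩ ^ 2 - 8)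
      + C (8 * k ^ 3) * (⟨0, 2, -1, 1⟩ ^ 3 - 8 * ⟨0, 2, -1, 1⟩ - 8)) (by
    have hU : U s k = C s - C (2 * k) * ⟨0, 2, -1, 1⟩ := by
      have : ∀ r : ℤ, C r = ⟨r, 0, 0, 0⟩ := fun _ => rfl
      rw [this, this]
      ext <;> simp [sub_eq_add_neg, add_def, neg_def, mul_def, U] <;> ring
    have h4 : (⟨0, 2, -1, 1⟩ : Q4 ℤ) ^ 4 = 8 * ⟨0, 2, -1, 1⟩ ^ 2 + 8 * ⟨0, 2, -1, 1⟩ + 4 := by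
      decide +kernel
    have hC := congrArg (C : ℤ →+* Q4 ℤ) h
    rw [hU]
    simp only [map_sub, map_mul, map_pow, map_one, map_ofNat C] at hC ⊢
    linear_combination hC - 16 * (C k) ^ 4 * h4)

theorem uU_val (s k : ℤ) (h) : ((uU s k h : (Q4 ℤ)ˣ) : Q4 ℤ) = U s k := rfl

theorem thue_of_units
    (hU : ∀ N : ℕ, ∀ u : (Q4 ℤ)ˣ, ∃ w : (Q4 ℤ)ˣ, ∃ A B : ℕ, ∃ σ : ℤ, (σ = 1 ∨ σ = -1) ∧
      (u : Q4 ℤ) * (w : Q4 ℤ) ^ (2 ^ N) = C σ * (e1 ^ A * e2 ^ B))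
    (s k : ℤ) (h : s ^ 4 - 32 * s ^ 2 * k ^ 2 - 64 * s * k ^ 3 - 64 * k ^ 4 = 1) : k = 0 := by
  obtain ⟨w, A, B, σ, hσ, hw⟩ := hU (k.natAbs + 7 + 2) (uU s k h)
  rw [uU_val] at hw
  obtain ⟨y, hy⟩ := unit_pow w (k.natAbs + 7)
  have hσ2 : σ * σ = 1 := by rcases hσ with rfl | rfl <;> norm_num
  have hCσ : (C σ : Q4 ℤ) * C σ = 1 := by rw [← map_mul, hσ2, map_one]
  have hx : (e1 ^ A * e2 ^ B : Q4 ℤ) = C σ * U s k + 2 ^ (k.natAbs + 8) * (C σ * U s k * y) := by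
    rw [hy] at hw
    linear_combination (-(e1 ^ A * e2 ^ B : Q4 ℤ)) * hCσ - C σ * hw
  have hcoord : ∀ x : Q4 ℤ, x = e1 ^ A * e2 ^ B →
      (2 : ℤ) ^ 8 ∣ x.b + 2 * x.c ∧ (2 : ℤ) ^ 8 ∣ x.c + x.d ∧ 2 ∣ x.c := by
    rintro x rfl
    rw [hx]
    generalize (C σ * U s k * y) = z
    simp only [two_pow_mul, C_mul, add_def, U]
    simp only [pow_add]
    refine ⟨⟨2 ^ k.natAbs * (z.b + 2 * z.c), by ring⟩, ⟨2 ^ k.natAbs * (z.c + z.d), by ring⟩,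
      ⟨σ * k + 2 ^ k.natAbs * 2 ^ 7 * z.c, by ring⟩⟩
  obtain ⟨d1, d2, d3⟩ := hcoord _ rfl
  -- modulo 16
  have m16 := check16 ⟨A % 32, Nat.mod_lt _ (by norm_num)⟩ ⟨B % 16, Nat.mod_lt _ (by norm_num)⟩
    (map (Int.castRingHom (ZMod 16)) (e1 ^ A * e2 ^ B)) (by
      have h1 : (e1 : Q4 (ZMod 16)) ^ 32 = 1 := by decide +kernel
      have h2 : (e2 : Q4 (ZMod 16)) ^ 16 = 1 := by decide +kernel
      rw [map_mul, map_pow, map_pow, map_e1, map_e2, pow_eq_pow_mod A h1, pow_eq_pow_mod B h2])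
  generalize hxx : (e1 ^ A * e2 ^ B : Q4 ℤ) = x at m16 d1 d2 d3
  have c1 : (map (Int.castRingHom (ZMod 16)) x).b + 2 * (map (Int.castRingHom (ZMod 16)) x).c = 0 := by
    have : ((x.b + 2 * x.c : ℤ) : ZMod 16) = 0 :=
      (ZMod.intCast_zmod_eq_zero_iff_dvd _ 16).2 (dvd_trans (by norm_num) d1)
    simpa [map] using this
  have c2 : (map (Int.castRingHom (ZMod 16)) x).c + (map (Int.castRingHom (ZMod 16)) x).d = 0 := by
    have : ((x.c + x.d : ℤ) : ZMod 16) = 0 :=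
      (ZMod.intCast_zmod_eq_zero_iff_dvd _ 16).2 (dvd_trans (by norm_num) d2)
    simpa [map] using this
  have c3 : 8 * (map (Int.castRingHom (ZMod 16)) x).c = 0 := by
    have : ((8 * x.c : ℤ) : ZMod 16) = 0 :=
      (ZMod.intCast_zmod_eq_zero_iff_dvd _ 16).2 (by push_cast; omega)
    simpa [map] using this
  replace m16 := m16 c1 c2 c3
  simp only at m16
  -- modulo 7
  have m16' : A % 16 = 0 ∧ B % 8 = 0 := by
    by_contra hcon
    have hA : A % 16 = 8 := by omega
    have hB : B % 8 = 4 := by omega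
    obtain ⟨A', rfl⟩ : ∃ A', A = 16 * A' + 8 := ⟨A / 16, by omega⟩
    obtain ⟨B', rfl⟩ : ∃ B', B = 8 * B' + 4 := ⟨B / 8, by omega⟩
    have h7 := check7 (s : ZMod 7) (k : ZMod 7) (by
      have := congrArg (Int.cast : ℤ → ZMod 7) h
      push_cast at this
      exact this)
    have hw7 := congrArg (map (Int.castRingHom (ZMod 7))) hw
    rw [map_mul, map_pow, map_U, map_mul, map_mul, map_pow, map_pow, map_e1, map_e2] at hw7
    have hw75 := congrArg (fun z => z ^ 75) hw7
    simp only [mul_pow, ← pow_mul] at hw75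
    have hone : (map (Int.castRingHom (ZMod 7)) (w : Q4 ℤ)) ^ (2 ^ (k.natAbs + 7 + 2) * 75) = 1 := by
      rw [show 2 ^ (k.natAbs + 7 + 2) * 75 = 2400 * (2 ^ (k.natAbs + 4)) by ring, pow_mul, unit7,
        one_pow]
    have h1 : (e1 : Q4 (ZMod 7)) ^ 1200 = -1 := by
      have h0 : (e1 : Q4 (ZMod 7)) ^ 100 = (e1 : Q4 (ZMod 7)) ^ 100 := rfl
      have ha : (e1 : Q4 (ZMod 7)) ^ 1200 = ((e1 ^ 30) ^ 40) := by rw [← pow_mul]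
      rw [ha]; decide +kernel
    have h2 : (e2 : Q4 (ZMod 7)) ^ 600 = 1 := by
      have ha : (e2 : Q4 (ZMod 7)) ^ 600 = ((e2 ^ 30) ^ 20) := by rw [← pow_mul]
      rw [ha]; decide +kernel
    rw [hone, mul_one, show (16 * A' + 8) * 75 = 1200 * A' + 600 by ring,
      show (8 * B' + 4) * 75 = 600 * B' + 300 by ring, pow_add, pow_add, pow_mul, pow_mul, h1, h2,
      one_pow, one_mul] at hw75
    have hs : ∀ z : Q4 (ZMod 7), map (Int.castRingHom (ZMod 7)) (C σ) ^ 75 * ((-1) ^ A' * z) = z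
        ∨ map (Int.castRingHom (ZMod 7)) (C σ) ^ 75 * ((-1) ^ A' * z) = -z := by
      intro z
      have h75 : (-1 : Q4 (ZMod 7)) ^ 75 = -1 := by decide +kernel
      rcases hσ with rfl | rfl <;> rcases neg_one_pow_eq_or (Q4 (ZMod 7)) A' with h' | h' <;>
        simp [h', h75]
    rw [mul_assoc] at hw75
    rcases hs (e1 ^ 600 * e2 ^ 300) with h' | h'
    · rw [h'] at hw75; exact h7.1 hw75
    · rw [h'] at hw75; exact h7.2 hw75
  obtain ⟨A1, rfl⟩ : ∃ A', A = 16 * A' := ⟨A / 16, by omega⟩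
  obtain ⟨B1, rfl⟩ : ∃ B', B = 8 * B' := ⟨B / 8, by omega⟩
  -- modulo 256
  have m256 := check256 ⟨A1 % 32, Nat.mod_lt _ (by norm_num)⟩ ⟨B1 % 32, Nat.mod_lt _ (by norm_num)⟩
    (map (Int.castRingHom (ZMod 256)) x) (by
      have h1 : ((e1 : Q4 (ZMod 256)) ^ 16) ^ 32 = 1 := by decide +kernel
      have h2 : ((e2 : Q4 (ZMod 256)) ^ 8) ^ 32 = 1 := by decide +kernel
      rw [← hxx, map_mul, map_pow, map_pow, map_e1, map_e2, pow_mul, pow_mul,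
        pow_eq_pow_mod A1 h1, pow_eq_pow_mod B1 h2])
  have c1 : (map (Int.castRingHom (ZMod 256)) x).b + 2 * (map (Int.castRingHom (ZMod 256)) x).c = 0 := by
    have : ((x.b + 2 * x.c : ℤ) : ZMod 256) = 0 :=
      (ZMod.intCast_zmod_eq_zero_iff_dvd _ 256).2 (dvd_trans (by norm_num) d1)
    simpa [map] using this
  have c2 : (map (Int.castRingHom (ZMod 256)) x).c + (map (Int.castRingHom (ZMod 256)) x).d = 0 := by
    have : ((x.c + x.d : ℤ) : ZMod 256) = 0 :=
      (ZMod.intCast_zmod_eq_zero_iff_dvd _ 256).2 (dvd_trans (by norm_num) d2)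
    simpa [map] using this
  replace m256 := m256 c1 c2
  simp only at m256
  obtain ⟨A2, rfl⟩ : ∃ A', A1 = 4 * A' := ⟨A1 / 4, by omega⟩
  obtain ⟨B2, rfl⟩ : ∃ B', B1 = 4 * B' := ⟨B1 / 4, by omega⟩
  have hdiv : (2 : ℤ) ^ k.natAbs ∣ k := by
    apply descent_end A2 B2 k.natAbs s k σ (C σ * U s k * y) hσ
    rw [← hx, hxx, ← hxx, ← pow_mul, ← pow_mul]
    congr 2 <;> ring
  by_contra hk
  have h1 := Int.natAbs_dvd_natAbs.2 hdiv
  have h2 := Nat.le_of_dvd (Int.natAbs_pos.2 hk) h1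
  rw [Int.natAbs_pow] at h2
  exact absurd h2 (not_le.2 (Nat.lt_two_pow_self))

open Polynomial NumberField

theorem quartic_irr : Irreducible (X ^ 4 - 2 * X ^ 3 + 2 * X ^ 2 - 2 : ℚ[X]) := by
  have hdeg : (X ^ 4 - 2 * X ^ 3 + 2 * X ^ 2 - 2 : ℤ[X]).natDegree = 4 := by compute_degree!
  have hmon : (X ^ 4 - 2 * X ^ 3 + 2 * X ^ 2 - 2 : ℤ[X]).Monic := by monicity!
  have hirr : Irreducible (X ^ 4 - 2 * X ^ 3 + 2 * X ^ 2 - 2 : ℤ[X]) := by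
    have hp : (Ideal.span {(2 : ℤ)}).IsPrime :=
      (Ideal.span_singleton_prime (by norm_num)).2 Int.prime_two
    apply irreducible_of_eisenstein_criterion hp
    · rw [hmon.leadingCoeff, Ideal.mem_span_singleton]; norm_num
    · intro n hn
      rw [degree_eq_natDegree hmon.ne_zero, hdeg] at hn
      have hn' : n < 4 := by exact_mod_cast hn
      rw [Ideal.mem_span_singleton]
      interval_cases n <;> simp [coeff_X, coeff_ofNat_mul, coeff_X_pow]
    · rw [degree_eq_natDegree hmon.ne_zero, hdeg]; norm_num
    · rw [Ideal.span_singleton_pow, Ideal.mem_span_singleton]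
      simp [coeff_X, coeff_ofNat_mul, coeff_X_pow]
    · exact hmon.isPrimitive
  have := (hmon.irreducible_iff_irreducible_map_fraction_map (K := ℚ)).1 hirr
  simpa using this

/-- the quartic field -/
abbrev K4 := AdjoinRoot (X ^ 4 - 2 * X ^ 3 + 2 * X ^ 2 - 2 : ℚ[X])

instance : Fact (Irreducible (X ^ 4 - 2 * X ^ 3 + 2 * X ^ 2 - 2 : ℚ[X])) := ⟨quartic_irr⟩

theorem quartic_monic : (X ^ 4 - 2 * X ^ 3 + 2 * X ^ 2 - 2 : ℚ[X]).Monic := by monicity!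
theorem quartic_natDegree : (X ^ 4 - 2 * X ^ 3 + 2 * X ^ 2 - 2 : ℚ[X]).natDegree = 4 := by
  compute_degree!

instance : NumberField K4 where
  to_charZero := charZero_of_injective_algebraMap (algebraMap ℚ K4).injective
  to_finiteDimensional := quartic_monic.finite_adjoinRoot

theorem K4_finrank : Module.finrank ℚ K4 = 4 := by
  rw [(AdjoinRoot.powerBasis quartic_monic.ne_zero).finrank, AdjoinRoot.powerBasis_dim,
    quartic_natDegree]

theorem K4_root : (AdjoinRoot.root _ : K4) ^ 4 =
    2 * (AdjoinRoot.root _ : K4) ^ 3 - 2 * (AdjoinRoot.root _ : K4) ^ 2 + 2 := by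
  have h := AdjoinRoot.eval₂_root (X ^ 4 - 2 * X ^ 3 + 2 * X ^ 2 - 2 : ℚ[X])
  simp only [eval₂_add, eval₂_sub, eval₂_mul, eval₂_pow, eval₂_X, eval₂_ofNat] at h
  linear_combination h

theorem K4_int : IsIntegral ℤ (AdjoinRoot.root _ : K4) := by
  refine ⟨X ^ 4 - 2 * X ^ 3 + 2 * X ^ 2 - 2, by monicity!, ?_⟩
  simp only [eval₂_add, eval₂_sub, eval₂_mul, eval₂_pow, eval₂_X, eval₂_ofNat]
  linear_combination K4_root

/-- evaluation -/
def evalHom {A : Type*} [CommRing A] (z : A) (hz : z ^ 4 = 2 * z ^ 3 - 2 * z ^ 2 + 2) :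
    Q4 ℤ →+* A where
  toFun x := x.a + x.b * z + x.c * z ^ 2 + x.d * z ^ 3
  map_one' := by simp [one_def]
  map_zero' := by simp [zero_def]
  map_add' x y := by simp only [add_def]; push_cast; ring
  map_mul' x y := by
    simp only [mul_def]; push_cast
    linear_combination (-((x.b:A) * y.d + x.c * y.c + x.d * y.b) - (x.c * y.d + x.d * y.c) * (z + 2)
      - (x.d * y.d) * (z ^ 2 + 2 * z + 2)) * hz

/-- the generator in the ring of integers -/
noncomputable def piK4 : 𝓞 K4 := ⟨AdjoinRoot.root _, K4_int⟩

theorem piK4_coe : algebraMap (𝓞 K4) K4 piK4 = AdjoinRoot.root _ := rfl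

/-- the inclusion in the ring of integers -/
noncomputable def toK4 : Q4 ℤ →+* 𝓞 K4 := evalHom piK4 (by
  apply RingOfIntegers.ext
  exact K4_root)

theorem toK4_inj : Function.Injective toK4 := by
  rw [injective_iff_map_eq_zero]
  intro x hx
  have h1 : (x.a : K4) + (x.b : K4) * (AdjoinRoot.root _ : K4)
      + (x.c : K4) * (AdjoinRoot.root _ : K4) ^ 2 + (x.d : K4) * (AdjoinRoot.root _ : K4) ^ 3 = 0 := by
    have := congrArg (algebraMap (𝓞 K4) K4) hx
    have e : toK4 x = x.a + x.b * piK4 + x.c * piK4 ^ 2 + x.d * piK4 ^ 3 := rfl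
    rw [e, map_add, map_add, map_add, map_mul, map_mul, map_mul, map_pow, map_pow, map_intCast,
      map_intCast, map_intCast, map_intCast, piK4_coe, map_zero] at this
    exact this
  have h2 : AdjoinRoot.mk (X ^ 4 - 2 * X ^ 3 + 2 * X ^ 2 - 2 : ℚ[X])
      (Polynomial.C (x.a : ℚ) + Polynomial.C (x.b : ℚ) * X + Polynomial.C (x.c : ℚ) * X ^ 2 + Polynomial.C (x.d : ℚ) * X ^ 3) = 0 := by
    simpa using h1
  rw [AdjoinRoot.mk_eq_zero] at h2
  have h3 := Polynomial.eq_zero_of_dvd_of_natDegree_lt h2 (by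
    rw [quartic_natDegree]
    refine lt_of_le_of_lt ?_ (show 3 < 4 by norm_num)
    compute_degree)
  have e0 := congrArg (fun p => p.coeff 0) h3
  have e1 := congrArg (fun p => p.coeff 1) h3
  have e2 := congrArg (fun p => p.coeff 2) h3
  have e3 := congrArg (fun p => p.coeff 3) h3
  simp only [coeff_add, coeff_C_mul, coeff_X_pow, coeff_X, coeff_C, coeff_zero] at e0 e1 e2 e3
  norm_num at e0 e1 e2 e3
  ext <;> simp [zero_def, *]

theorem quartic_roots : ∃ r s : ℝ, r < 0 ∧ 0 < s ∧ r ^ 4 - 2 * r ^ 3 + 2 * r ^ 2 - 2 = 0 ∧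
    s ^ 4 - 2 * s ^ 3 + 2 * s ^ 2 - 2 = 0 := by
  have hc : Continuous (fun r : ℝ => r ^ 4 - 2 * r ^ 3 + 2 * r ^ 2 - 2) := by fun_prop
  obtain ⟨r, hr, hr0⟩ := intermediate_value_Icc' (show (-1 : ℝ) ≤ 0 by norm_num) hc.continuousOn
    (show (0 : ℝ) ∈ Set.Icc _ _ by norm_num)
  obtain ⟨s, hs, hs0⟩ := intermediate_value_Icc (show (0 : ℝ) ≤ 2 by norm_num) hc.continuousOn
    (show (0 : ℝ) ∈ Set.Icc _ _ by norm_num)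
  simp only at hr0 hs0
  refine ⟨r, s, lt_of_le_of_ne hr.2 ?_, lt_of_le_of_ne hs.1 ?_, hr0, hs0⟩
  · rintro rfl; norm_num at hr0
  · rintro rfl; norm_num at hs0

theorem K4_real : Nonempty (K4 →+* ℝ) := by
  obtain ⟨r, s, -, -, hr, -⟩ := quartic_roots
  exact ⟨AdjoinRoot.lift (algebraMap ℚ ℝ) r (by
    simp only [eval₂_add, eval₂_sub, eval₂_mul, eval₂_pow, eval₂_X, eval₂_ofNat]
    linear_combination hr)⟩

theorem K4_rank : NumberField.Units.rank K4 < 3 := by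
  obtain ⟨r, s, hr0, hs0, hr, hs⟩ := quartic_roots
  have hD : 0 < 3 * (r + s) ^ 2 - 4 * (r + s) + 4 - 4 * (r * s) := by
    nlinarith [mul_pos (neg_pos.2 hr0) hs0, sq_nonneg (3 * (r + s) - 2)]
  set D := 3 * (r + s) ^ 2 - 4 * (r + s) + 4 - 4 * (r * s) with hDdef
  have hsq : (√D) ^ 2 = D := Real.sq_sqrt hD.le
  have hrs : (r + s) * (r ^ 2 + s ^ 2) - 2 * (r ^ 2 + r * s + s ^ 2) + 2 * (r + s) = 0 := by
    have hne : r - s ≠ 0 := by linarith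
    apply mul_left_cancel₀ hne
    linear_combination hr - hs
  let z : ℂ := ((2 - (r + s) : ℝ) : ℂ) / 2 + ((√D : ℝ) : ℂ) / 2 * Complex.I
  have hz2 : z ^ 2 + (r + s - 2) * z + ((r + s) ^ 2 - r * s - 2 * (r + s) + 2) = 0 := by
    have hsqC : ((√D : ℝ) : ℂ) ^ 2 = 3 * (r + s) ^ 2 - 4 * (r + s) + 4 - 4 * (r * s) := by
      rw [← Complex.ofReal_pow, hsq, hDdef]; push_cast; ring
    simp only [z]
    push_cast
    linear_combination (((√D : ℝ) : ℂ) ^ 2 / 4) * Complex.I_sq - hsqC / 4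
  have hrC : (r : ℂ) ^ 4 - 2 * r ^ 3 + 2 * r ^ 2 - 2 = 0 := by exact_mod_cast hr
  have hrsC : ((r : ℂ) + s) * (r ^ 2 + s ^ 2) - 2 * (r ^ 2 + r * s + s ^ 2) + 2 * (r + s) = 0 := by
    exact_mod_cast hrs
  have hz : z ^ 4 - 2 * z ^ 3 + 2 * z ^ 2 - 2 = 0 := by
    linear_combination (z - r) * (z - s) * hz2 + (z - r) * hrsC + hrC
  let φ : K4 →+* ℂ := AdjoinRoot.lift (algebraMap ℚ ℂ) z (by
    simp only [eval₂_add, eval₂_sub, eval₂_mul, eval₂_pow, eval₂_X, eval₂_ofNat]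
    linear_combination hz)
  have h := (rank_le_of_complex K4 φ (AdjoinRoot.root _) (by
    simp only [φ, AdjoinRoot.lift_root]
    have : z.im = √D / 2 := by simp [z]
    rw [this]
    have := Real.sqrt_pos.2 hD
    positivity)).2
  rw [K4_finrank] at h
  omega

/-- `ε₁` as a unit -/
def u1 : (Q4 ℤ)ˣ := Units.mkOfMulEqOne e1 ⟨-1, -1, 1, -1⟩ (by decide +kernel)

/-- `ε₂` as a unit -/
def u2 : (Q4 ℤ)ˣ := Units.mkOfMulEqOne e2 ⟨3, -4, 3, -1⟩ (by decide +kernel)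

theorem nonsq2 : ∀ A B : Fin 2, ∀ a b c d : ZMod 2,
    (e1 ^ (A : ℕ) * e2 ^ (B : ℕ) : Q4 (ZMod 2)) * (⟨a, b, c, d⟩ : Q4 (ZMod 2)) ^ 2 = 1 →
      A = 0 ∧ B = 0 := by
  decide +kernel

theorem zpow_split {G : Type*} [CommGroup G] (g : G) (c : ℤ) :
    ∃ A : Fin 2, ∃ t : G, g ^ c = g ^ (A : ℕ) * t ^ 2 ∧ (A = 0 ↔ Even c) := by
  rcases Int.even_or_odd' c with ⟨k, rfl | rfl⟩
  · exact ⟨0, g ^ k, by simp [mul_comm 2 k, zpow_mul], by simp⟩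
  · refine ⟨1, g ^ k, by simp [mul_comm 2 k, zpow_mul, zpow_add, mul_comm], by simp⟩

theorem unit_mod_sq (u : (Q4 ℤ)ˣ) : ∃ w : (Q4 ℤ)ˣ, ∃ A B : ℕ, ∃ σ : (Q4 ℤ)ˣ,
    (σ = 1 ∨ σ = -1) ∧ u * w ^ 2 = σ * (u1 ^ A * u2 ^ B) := by
  obtain ⟨τ⟩ := K4_real
  obtain ⟨c, ⟨i, hi⟩, hrel⟩ := unit_relation K4 toK4 toK4_inj τ 3 K4_rank ![u, u1, u2]
  obtain ⟨σ, hσ, hrel⟩ : ∃ σ : (Q4 ℤ)ˣ, (σ = 1 ∨ σ = -1) ∧ u ^ c 0 * u1 ^ c 1 * u2 ^ c 2 = σ := by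
    rcases hrel with h | h
    · exact ⟨1, Or.inl rfl, by simpa [Fin.prod_univ_three] using h⟩
    · exact ⟨-1, Or.inr rfl, by simpa [Fin.prod_univ_three] using h⟩
  obtain ⟨D, t0, h0, hD⟩ := zpow_split u (c 0)
  obtain ⟨A, t1, h1, hA⟩ := zpow_split u1 (c 1)
  obtain ⟨B, t2, h2, hB⟩ := zpow_split u2 (c 2)
  rw [h0, h1, h2] at hrel
  have hD' : D = 0 ∨ D = 1 := by omega
  rcases hD' with rfl | rfl
  · exfalso
    have h := congrArg (fun v : (Q4 ℤ)ˣ => map (Int.castRingHom (ZMod 2)) (v : Q4 ℤ)) hrel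
    have hσ1 : map (Int.castRingHom (ZMod 2)) (σ : Q4 ℤ) = 1 := by
      rcases hσ with rfl | rfl
      · simp
      · simp only [Units.val_neg, Units.val_one, map_neg, map_one]; decide +kernel
    have hu1 : map (Int.castRingHom (ZMod 2)) (u1 : Q4 ℤ) = e1 := map_e1 _
    have hu2 : map (Int.castRingHom (ZMod 2)) (u2 : Q4 ℤ) = e2 := map_e2 _
    simp only [hσ1, Units.val_mul, Units.val_pow_eq_pow_val, map_mul, map_pow, hu1, hu2] at h
    generalize map (Int.castRingHom (ZMod 2)) (t0 : Q4 ℤ) = s0 at h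
    generalize map (Int.castRingHom (ZMod 2)) (t1 : Q4 ℤ) = s1 at h
    generalize map (Int.castRingHom (ZMod 2)) (t2 : Q4 ℤ) = s2 at h
    have h' : e1 ^ (A : ℕ) * e2 ^ (B : ℕ) * (s0 * s1 * s2) ^ 2 = 1 := by
      rw [← h]; simp; ring
    have := nonsq2 A B _ _ _ _ h'
    rw [hA, hB] at this
    have hD0 := hD.1 rfl
    fin_cases i
    · exact (Int.not_odd_iff_even.2 hD0) hi
    · exact (Int.not_odd_iff_even.2 this.1) hi
    · exact (Int.not_odd_iff_even.2 this.2) hi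
  · refine ⟨t0 * t1 * t2 * u1 ^ (A : ℕ) * u2 ^ (B : ℕ), A, B, σ, hσ, ?_⟩
    rw [← hrel]
    simp only [Fin.val_one, pow_one, mul_pow]
    generalize u1 ^ (A : ℕ) = a
    generalize u2 ^ (B : ℕ) = b
    ext : 1
    push_cast
    ring

theorem units_all : ∀ N : ℕ, ∀ u : (Q4 ℤ)ˣ, ∃ w : (Q4 ℤ)ˣ, ∃ A B : ℕ, ∃ σ : ℤ,
    (σ = 1 ∨ σ = -1) ∧ (u : Q4 ℤ) * (w : Q4 ℤ) ^ (2 ^ N) = C σ * (e1 ^ A * e2 ^ B) := by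
  intro N
  suffices h : ∀ u : (Q4 ℤ)ˣ, ∃ w : (Q4 ℤ)ˣ, ∃ A B : ℕ, ∃ σ : (Q4 ℤ)ˣ,
    (σ = 1 ∨ σ = -1) ∧ u * w ^ (2 ^ N) = σ * (u1 ^ A * u2 ^ B) by
    intro u
    obtain ⟨w, A, B, σ, hσ, h⟩ := h u
    have h' := congrArg Units.val h
    simp only [Units.val_mul, Units.val_pow_eq_pow_val] at h'
    rcases hσ with rfl | rfl
    · exact ⟨w, A, B, 1, Or.inl rfl, by rw [h']; simp; rfl⟩
    · exact ⟨w, A, B, -1, Or.inr rfl, by rw [h']; simp; rfl⟩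
  induction N with
  | zero => exact fun u => ⟨u⁻¹, 0, 0, 1, Or.inl rfl, by simp⟩
  | succ N ih =>
    intro u
    obtain ⟨w, A, B, σ, hσ, h⟩ := ih u
    obtain ⟨v, A', B', σ', hσ', h'⟩ := unit_mod_sq w⁻¹
    refine ⟨v, A + A' * 2 ^ N, B + B' * 2 ^ N, σ * σ' ^ 2 ^ N, ?_, ?_⟩
    · have : σ' ^ 2 ^ N = 1 ∨ σ' ^ 2 ^ N = -1 := by
        rcases hσ' with rfl | rfl
        · left; simp
        · exact neg_one_pow_eq_or _ _
      rcases hσ with rfl | rfl <;> rcases this with h | h <;> simp [h]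
    · have e : u * v ^ 2 ^ (N + 1) = (u * w ^ 2 ^ N) * (w⁻¹ * v ^ 2) ^ 2 ^ N := by
        rw [mul_pow, ← pow_mul, ← pow_succ', inv_pow]
        group
      rw [e, h, h', mul_pow, mul_pow, pow_add, pow_add, pow_mul, pow_mul]
      ext : 1
      push_cast
      ring

theorem thue (s k : ℤ) (h : s ^ 4 - 32 * s ^ 2 * k ^ 2 - 64 * s * k ^ 3 - 64 * k ^ 4 = 1) :
    k = 0 := thue_of_units units_all s k h

end Q4

namespace Cub

open Polynomial NumberField

theorem cubic_irr : Irreducible (X ^ 3 - X - 1 : ℚ[X]) :=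
  X_pow_sub_X_sub_one_irreducible_rat (by norm_num)

/-- the cubic field of discriminant `-23` -/
abbrev K3 := AdjoinRoot (X ^ 3 - X - 1 : ℚ[X])

instance : Fact (Irreducible (X ^ 3 - X - 1 : ℚ[X])) := ⟨cubic_irr⟩

theorem cubic_monic : (X ^ 3 - X - 1 : ℚ[X]).Monic := by monicity!
theorem cubic_natDegree : (X ^ 3 - X - 1 : ℚ[X]).natDegree = 3 := by compute_degree!

instance : NumberField K3 where
  to_charZero := charZero_of_injective_algebraMap (algebraMap ℚ K3).injective
  to_finiteDimensional := cubic_monic.finite_adjoinRoot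

theorem K3_finrank : Module.finrank ℚ K3 = 3 := by
  rw [(AdjoinRoot.powerBasis cubic_monic.ne_zero).finrank, AdjoinRoot.powerBasis_dim,
    cubic_natDegree]

theorem K3_root : (AdjoinRoot.root _ : K3) ^ 3 = (AdjoinRoot.root _ : K3) + 1 := by
  have h := AdjoinRoot.eval₂_root (X ^ 3 - X - 1 : ℚ[X])
  simp only [eval₂_sub, eval₂_pow, eval₂_X, eval₂_one] at h
  linear_combination h

theorem K3_int : IsIntegral ℤ (AdjoinRoot.root _ : K3) := by
  refine ⟨X ^ 3 - X - 1, by monicity!, ?_⟩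
  simp only [eval₂_sub, eval₂_pow, eval₂_X, eval₂_one]
  linear_combination K3_root

/-- the generator -/
noncomputable def rho : 𝓞 K3 := ⟨AdjoinRoot.root _, K3_int⟩

theorem rho_coe : algebraMap (𝓞 K3) K3 rho = AdjoinRoot.root _ := rfl

theorem rho_cube : rho ^ 3 = rho + 1 := by
  apply RingOfIntegers.ext
  exact K3_root

theorem coord_zero (a b c : ℤ) (h : (a : 𝓞 K3) + b * rho + c * rho ^ 2 = 0) :
    a = 0 ∧ b = 0 ∧ c = 0 := by
  have h1 : (a : K3) + (b : K3) * (AdjoinRoot.root _ : K3)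
      + (c : K3) * (AdjoinRoot.root _ : K3) ^ 2 = 0 := by
    have := congrArg (algebraMap (𝓞 K3) K3) h
    rw [map_add, map_add, map_mul, map_mul, map_pow, map_intCast,
      map_intCast, map_intCast, rho_coe, map_zero] at this
    exact this
  have h2 : AdjoinRoot.mk (X ^ 3 - X - 1 : ℚ[X])
      (C (a : ℚ) + C (b : ℚ) * X + C (c : ℚ) * X ^ 2) = 0 := by
    simpa using h1
  rw [AdjoinRoot.mk_eq_zero] at h2
  have h3 := Polynomial.eq_zero_of_dvd_of_natDegree_lt h2 (by
    rw [cubic_natDegree]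
    refine lt_of_le_of_lt ?_ (show 2 < 3 by norm_num)
    compute_degree)
  have e0 := congrArg (fun p => p.coeff 0) h3
  have e1 := congrArg (fun p => p.coeff 1) h3
  have e2 := congrArg (fun p => p.coeff 2) h3
  simp only [coeff_add, coeff_C_mul, coeff_X_pow, coeff_X, coeff_C, coeff_zero] at e0 e1 e2
  norm_num at e0 e1 e2
  exact ⟨e0, e1, e2⟩

theorem coord_eq {a b c a' b' c' : ℤ}
    (h : (a : 𝓞 K3) + b * rho + c * rho ^ 2 = a' + b' * rho + c' * rho ^ 2) :
    a = a' ∧ b = b' ∧ c = c' := by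
  have := coord_zero (a - a') (b - b') (c - c') (by push_cast; linear_combination h)
  omega

/-- the power basis -/
noncomputable def bas : Module.Basis (Fin 3) ℚ K3 :=
  (AdjoinRoot.powerBasis cubic_monic.ne_zero).basis.reindex
    (finCongr (by rw [AdjoinRoot.powerBasis_dim, cubic_natDegree]))

theorem bas_apply (i : Fin 3) : bas i = (AdjoinRoot.root _ : K3) ^ (i : ℕ) := by
  simp [bas]

theorem norm_delta : Algebra.norm ℚ (3 * (AdjoinRoot.root _ : K3) ^ 2 - 1) = 23 := by
  have h : LinearMap.mul ℚ K3 (3 * (AdjoinRoot.root _ : K3) ^ 2 - 1) =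
      Matrix.toLin bas bas !![-1, 3, 0; 0, 2, 3; 3, 0, 2] := by
    apply bas.ext
    intro i
    rw [Matrix.toLin_self, Fin.sum_univ_three]
    fin_cases i
    · simp [bas_apply, Algebra.smul_def]; ring
    · simp [bas_apply, Algebra.smul_def]; linear_combination 3 * K3_root
    · simp [bas_apply, Algebra.smul_def]; linear_combination 3 * AdjoinRoot.root _ * K3_root
  rw [Algebra.norm_apply]
  change LinearMap.det (LinearMap.mul ℚ K3 (3 * (AdjoinRoot.root _ : K3) ^ 2 - 1)) = 23
  rw [h, LinearMap.det_toLin, Matrix.det_fin_three]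
  simp
  norm_num

theorem minpoly_rho : minpoly ℤ rho = X ^ 3 - X - 1 := by
  have h1 := minpoly.isIntegrallyClosed_eq_field_fractions ℚ K3 (RingOfIntegers.isIntegral rho)
  rw [rho_coe] at h1
  have h2 : minpoly ℚ (AdjoinRoot.root _ : K3) = X ^ 3 - X - 1 := by
    refine (minpoly.eq_of_irreducible_of_monic cubic_irr ?_ cubic_monic).symm
    rw [map_sub, map_sub, map_pow, map_one, aeval_X, K3_root]
    ring
  rw [h2] at h1
  apply Polynomial.map_injective (algebraMap ℤ ℚ) (algebraMap ℤ ℚ).injective_int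
  rw [← h1]
  simp

theorem norm_deltaZ : Algebra.norm ℤ (3 * rho ^ 2 - 1) = 23 := by
  have h := Algebra.coe_norm_int (3 * rho ^ 2 - 1)
  have e : ((3 * rho ^ 2 - 1 : 𝓞 K3) : K3) = 3 * (AdjoinRoot.root _ : K3) ^ 2 - 1 := by
    change algebraMap (𝓞 K3) K3 _ = _
    rw [map_sub, map_mul, map_pow, rho_coe, map_one, map_ofNat]
  rw [e, norm_delta] at h
  exact_mod_cast h

theorem cond_discr : conductor ℤ rho = ⊤ ∧ (discr K3).natAbs = 23 := by
  have hadj : Algebra.adjoin ℚ {algebraMap (𝓞 K3) K3 rho} = ⊤ := by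
    rw [rho_coe]; exact AdjoinRoot.adjoinRoot_eq_top
  have h := conductor_mul_differentIdeal ℤ ℚ K3 rho hadj
  rw [minpoly_rho] at h
  have hd : aeval rho (derivative (X ^ 3 - X - 1 : ℤ[X])) = 3 * rho ^ 2 - 1 := by
    rw [derivative_sub, derivative_sub, derivative_X_pow, derivative_X, derivative_one, map_sub,
      map_sub, map_mul, map_pow, aeval_X, map_one, map_zero, sub_zero, aeval_C]
    simp
  rw [hd] at h
  have h2 := congrArg Ideal.absNorm h
  rw [map_mul, Ideal.absNorm_span_singleton, norm_deltaZ, absNorm_differentIdeal K3] at h2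
  have h3 : 2 < |discr K3| := abs_discr_gt_two (by rw [K3_finrank]; norm_num)
  have hp : Nat.Prime 23 := by norm_num
  have h4 : (discr K3).natAbs = 1 ∨ (discr K3).natAbs = 23 :=
    (Nat.dvd_prime hp).1 ⟨_, by rw [mul_comm]; exact h2.symm⟩
  have h5 : (discr K3).natAbs = 23 := by
    rcases h4 with h4 | h4
    · rw [Int.abs_eq_natAbs, h4] at h3; norm_num at h3
    · exact h4
  refine ⟨?_, h5⟩
  rw [h5] at h2
  rw [← Ideal.absNorm_eq_one_iff]
  have : Int.natAbs 23 = 23 := rfl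
  omega

theorem exists_coord (g : 𝓞 K3) : ∃ a b c : ℤ, g = a + b * rho + c * rho ^ 2 := by
  have h : g ∈ Algebra.adjoin ℤ {rho} := by
    rw [adjoin_eq_top_of_conductor_eq_top cond_discr.1]; trivial
  induction h using Algebra.adjoin_induction with
  | mem x hx => rw [Set.mem_singleton_iff] at hx; exact ⟨0, 1, 0, by rw [hx]; simp⟩
  | algebraMap r => exact ⟨r, 0, 0, by simp⟩
  | add x y _ _ hx hy =>
    obtain ⟨a, b, c, rfl⟩ := hx
    obtain ⟨a', b', c', rfl⟩ := hy
    exact ⟨a + a', b + b', c + c', by push_cast; ring⟩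
  | mul x y _ _ hx hy =>
    obtain ⟨a, b, c, rfl⟩ := hx
    obtain ⟨a', b', c', rfl⟩ := hy
    refine ⟨a * a' + b * c' + c * b', a * b' + b * a' + b * c' + c * b' + c * c',
      a * c' + b * b' + c * a' + c * c', ?_⟩
    push_cast
    linear_combination (b * c' + c * b' + c * c' * rho) * rho_cube

theorem cubic_real_root : ∃ r : ℝ, r ^ 3 = r + 1 := by
  have hc : Continuous (fun r : ℝ => r ^ 3 - r - 1) := by fun_prop
  obtain ⟨r, hr, hr0⟩ := intermediate_value_Icc (show (0 : ℝ) ≤ 2 by norm_num) hc.continuousOn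
    (show (0 : ℝ) ∈ Set.Icc _ _ by norm_num)
  simp only at hr0
  exact ⟨r, by linarith⟩

theorem real_bounds {r : ℝ} (h : r ^ 3 = r + 1) : 1 < r ∧ r < 7 / 5 := by
  have h1 : 1 < r := by
    by_contra hc
    push Not at hc
    rcases le_total r (-1) with h2 | h2
    · nlinarith [sq_nonneg r, mul_nonneg_of_nonpos_of_nonpos (show r ≤ 0 by linarith) (show 1 - r ^ 2 ≤ 0 by nlinarith)]
    · rcases le_total r 0 with h3 | h3
      · have : r ^ 3 ≤ 0 := by nlinarith [sq_nonneg r]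
        have : r = -1 := by linarith
        subst this; norm_num at h
      · nlinarith [mul_nonneg h3 (show 0 ≤ 1 - r ^ 2 by nlinarith)]
  refine ⟨h1, ?_⟩
  by_contra hc
  push Not at hc
  nlinarith [mul_nonneg (show 0 ≤ r by linarith) (show 0 ≤ r ^ 2 - 49 / 25 by nlinarith)]

theorem K3_real : Nonempty (K3 →+* ℝ) := by
  obtain ⟨r, hr⟩ := cubic_real_root
  exact ⟨AdjoinRoot.lift (algebraMap ℚ ℝ) r (by
    simp only [eval₂_sub, eval₂_pow, eval₂_X, eval₂_one]
    linear_combination hr)⟩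

theorem K3_places : 1 ≤ InfinitePlace.nrComplexPlaces K3 ∧
    NumberField.Units.rank K3 + 2 ≤ Module.finrank ℚ K3 := by
  obtain ⟨r, hr⟩ := cubic_real_root
  obtain ⟨h1, h2⟩ := real_bounds hr
  have hD : 0 < 3 * r ^ 2 - 4 := by
    by_contra hc
    push Not at hc
    nlinarith
  set D := 3 * r ^ 2 - 4 with hDdef
  have hsq : (√D) ^ 2 = D := Real.sq_sqrt hD.le
  let z : ℂ := ((-r : ℝ) : ℂ) / 2 + ((√D : ℝ) : ℂ) / 2 * Complex.I
  have hz2 : z ^ 2 + r * z + (r ^ 2 - 1) = 0 := by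
    have hsqC : ((√D : ℝ) : ℂ) ^ 2 = 3 * r ^ 2 - 4 := by
      rw [← Complex.ofReal_pow, hsq, hDdef]; push_cast; ring
    simp only [z]
    push_cast
    linear_combination (((√D : ℝ) : ℂ) ^ 2 / 4) * Complex.I_sq - hsqC / 4
  have hrC : (r : ℂ) ^ 3 = r + 1 := by exact_mod_cast hr
  have hz : z ^ 3 - z - 1 = 0 := by
    linear_combination (z - r) * hz2 + hrC
  let φ : K3 →+* ℂ := AdjoinRoot.lift (algebraMap ℚ ℂ) z (by
    simp only [eval₂_sub, eval₂_pow, eval₂_X, eval₂_one]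
    linear_combination hz)
  exact rank_le_of_complex K3 φ (AdjoinRoot.root _) (by
    simp only [φ, AdjoinRoot.lift_root]
    have : z.im = √D / 2 := by simp [z]
    rw [this]
    have := Real.sqrt_pos.2 hD
    positivity)

theorem K3_rank : NumberField.Units.rank K3 < 2 := by
  have := K3_places.2
  rw [K3_finrank] at this
  omega

theorem K3_pid : IsPrincipalIdealRing (𝓞 K3) := by
  apply RingOfIntegers.isPrincipalIdealRing_of_abs_discr_lt
  have h1 : InfinitePlace.nrComplexPlaces K3 = 1 := by
    have h2 := InfinitePlace.card_add_two_mul_card_eq_rank K3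
    have h3 := K3_places.1
    rw [K3_finrank] at h2
    omega
  rw [h1, K3_finrank, Int.abs_eq_natAbs, cond_discr.2]
  have h3 : (3 : ℝ) < Real.pi := Real.pi_gt_three
  have hf : ((Nat.factorial 3 : ℕ) : ℝ) = 6 := by norm_num [Nat.factorial]
  rw [hf]
  push_cast
  nlinarith


/-- `ρ` as a unit -/
noncomputable def urho : (𝓞 K3)ˣ := Units.mkOfMulEqOne rho (rho ^ 2 - 1) (by
  linear_combination rho_cube)

theorem nonsq4 : ∀ u v w : ZMod 4, u ^ 2 + 2 * v * w = 0 → v ^ 2 + 2 * u * w + w ^ 2 = 0 →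
    2 * (2 * u * v + 2 * v * w + w ^ 2) = 0 := by decide +kernel

theorem sq_coord (u v w : ℤ) : ((u : 𝓞 K3) + v * rho + w * rho ^ 2) ^ 2 =
    ((u ^ 2 + 2 * v * w : ℤ) : 𝓞 K3) + ((2 * u * v + 2 * v * w + w ^ 2 : ℤ) : 𝓞 K3) * rho
      + ((v ^ 2 + 2 * u * w + w ^ 2 : ℤ) : 𝓞 K3) * rho ^ 2 := by
  push_cast
  linear_combination (2 * v * w + w ^ 2 * rho) * rho_cube

theorem rho_nonsq (σ : ℤ) (hσ : σ = 1 ∨ σ = -1) (t : 𝓞 K3) : t ^ 2 ≠ σ * rho := by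
  intro h
  obtain ⟨u, v, w, rfl⟩ := exists_coord t
  rw [sq_coord] at h
  obtain ⟨h1, h2, h3⟩ := coord_eq (a' := 0) (b' := σ) (c' := 0) (by rw [h]; push_cast; ring)
  have := nonsq4 u v w (by exact_mod_cast congrArg (Int.cast : ℤ → ZMod 4) h1)
    (by exact_mod_cast congrArg (Int.cast : ℤ → ZMod 4) h3)
  have h4 : ((2 * (2 * u * v + 2 * v * w + w ^ 2) : ℤ) : ZMod 4) = 0 := by
    push_cast; exact this
  rw [h2] at h4
  rcases hσ with rfl | rfl
  · revert h4; decide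
  · revert h4; decide

theorem zpow_split {G : Type*} [CommGroup G] (g : G) (c : ℤ) :
    ∃ A : Fin 2, ∃ t : G, g ^ c = g ^ (A : ℕ) * t ^ 2 ∧ (A = 0 ↔ Even c) := by
  rcases Int.even_or_odd' c with ⟨k, rfl | rfl⟩
  · exact ⟨0, g ^ k, by simp [mul_comm 2 k, zpow_mul], by simp⟩
  · refine ⟨1, g ^ k, by simp [mul_comm 2 k, zpow_mul, zpow_add, mul_comm], by simp⟩

theorem unit_mod_sq (u : (𝓞 K3)ˣ) : ∃ w : 𝓞 K3, ∃ A : Fin 2, ∃ σ : ℤ,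
    (σ = 1 ∨ σ = -1) ∧ (u : 𝓞 K3) = σ * rho ^ (A : ℕ) * w ^ 2 := by
  obtain ⟨τ⟩ := K3_real
  obtain ⟨c, ⟨i, hi⟩, hrel⟩ := unit_relation K3 (RingHom.id (𝓞 K3)) Function.injective_id τ 2
    K3_rank ![u, urho]
  obtain ⟨σ, hσ, hrel⟩ : ∃ σ : ℤ, (σ = 1 ∨ σ = -1) ∧
      ((u ^ c 0 * urho ^ c 1 : (𝓞 K3)ˣ) : 𝓞 K3) = σ := by
    rcases hrel with h | h
    · exact ⟨1, Or.inl rfl, by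
        rw [Fin.prod_univ_two] at h
        have := congrArg Units.val h
        simpa using this⟩
    · exact ⟨-1, Or.inr rfl, by
        rw [Fin.prod_univ_two] at h
        have := congrArg Units.val h
        simpa using this⟩
  have hσ2 : (σ : 𝓞 K3) * σ = 1 := by rcases hσ with rfl | rfl <;> simp
  obtain ⟨D, t0, h0, hD⟩ := zpow_split u (c 0)
  obtain ⟨A, t1, h1, hA⟩ := zpow_split urho (c 1)
  rw [h0, h1] at hrel
  have hur : (urho : 𝓞 K3) = rho := rfl
  have ht0 : (t0 : 𝓞 K3) * (t0⁻¹ : (𝓞 K3)ˣ) = 1 := Units.mul_inv t0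
  have ht1 : (t1 : 𝓞 K3) * (t1⁻¹ : (𝓞 K3)ˣ) = 1 := Units.mul_inv t1
  simp only [Units.val_mul, Units.val_pow_eq_pow_val, hur] at hrel
  have hD' : D = 0 ∨ D = 1 := by omega
  have hA' : A = 0 ∨ A = 1 := by omega
  rcases hD' with rfl | rfl
  · exfalso
    rcases hA' with rfl | rfl
    · have a := hD.1 rfl
      have b := hA.1 rfl
      fin_cases i
      · exact (Int.not_odd_iff_even.2 a) hi
      · exact (Int.not_odd_iff_even.2 b) hi
    · simp only [Fin.val_zero, pow_zero, one_mul, Fin.val_one, pow_one] at hrel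
      generalize ((t0⁻¹ : (𝓞 K3)ˣ) : 𝓞 K3) = s0 at ht0
      generalize ((t1⁻¹ : (𝓞 K3)ˣ) : 𝓞 K3) = s1 at ht1
      generalize (t0 : 𝓞 K3) = t0 at *
      generalize (t1 : 𝓞 K3) = t1 at *
      apply rho_nonsq σ hσ (rho * t0 * t1)
      linear_combination rho * hrel
  · have hr2 : (rho ^ (A : ℕ)) * (rho ^ 2 - 1) ^ (A : ℕ) = 1 := by
      rw [← mul_pow, show rho * (rho ^ 2 - 1) = 1 by linear_combination rho_cube, one_pow]
    refine ⟨(rho ^ 2 - 1) ^ (A : ℕ) * (t0⁻¹ : (𝓞 K3)ˣ) * (t1⁻¹ : (𝓞 K3)ˣ), A, σ, hσ, ?_⟩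
    rw [← hrel]
    simp only [Fin.val_one, pow_one]
    generalize ((t0⁻¹ : (𝓞 K3)ˣ) : 𝓞 K3) = s0 at *
    generalize ((t1⁻¹ : (𝓞 K3)ˣ) : 𝓞 K3) = s1 at *
    generalize (t0 : 𝓞 K3) = t0 at *
    generalize (t1 : 𝓞 K3) = t1 at *
    generalize (rho ^ 2 - 1) ^ (A : ℕ) = q at *
    generalize (rho ^ (A : ℕ)) = p at *
    have e : (u : 𝓞 K3) * t0 ^ 2 * (p * t1 ^ 2) * p * (q * s0 * s1) ^ 2
      = u * (p * q) ^ 2 * (t0 * s0) ^ 2 * (t1 * s1) ^ 2 := by ring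
    rw [e, hr2, ht0, ht1]
    ring

theorem factor (x y : ℤ) (hx : 2 ≤ x) (h : y ^ 2 = x ^ 3 - 2 * x ^ 2 + x - 1) :
    ∃ g : 𝓞 K3, ∃ A : Fin 2, (x : 𝓞 K3) - rho ^ 2 = rho ^ (A : ℕ) * g ^ 2 := by
  have := K3_pid
  have h23 : ¬ (23 : ℤ) ∣ (x - 8) := by
    rintro ⟨z, hz⟩
    obtain rfl : x = 8 + 23 * z := by omega
    have hp : Prime (23 : ℤ) := Int.prime_iff_natAbs_prime.2 (by norm_num)
    have hy : (23 : ℤ) ∣ y := by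
      apply hp.dvd_of_dvd_pow (n := 2)
      exact ⟨17 + 161 * z + 23 * 22 * z ^ 2 + 529 * z ^ 3, by rw [h]; ring⟩
    obtain ⟨c, rfl⟩ := hy
    have e : 23 * c ^ 2 = 17 + 23 * (7 * z + 22 * z ^ 2 + 23 * z ^ 3) := by
      apply mul_left_cancel₀ (show (23 : ℤ) ≠ 0 by norm_num)
      linear_combination h
    omega
  have hcop : IsCoprime (23 : ℤ) (x - 8) :=
    (Int.prime_iff_natAbs_prime.2 (by norm_num)).coprime_iff_not_dvd.2 h23
  obtain ⟨m, n, hmn⟩ := hcop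
  have hC : (m : 𝓞 K3) * 23 + n * (x - 8) = 1 := by exact_mod_cast hmn
  have hy : (y : 𝓞 K3) ^ 2 = x ^ 3 - 2 * x ^ 2 + x - 1 := by exact_mod_cast h
  have hfac : ((x : 𝓞 K3) - rho ^ 2) *
      (x ^ 2 + (rho ^ 2 - 2) * x + rho ^ 4 - 2 * rho ^ 2 + 1) = (y : 𝓞 K3) ^ 2 := by
    rw [hy]
    linear_combination (-(rho ^ 3) + rho - 1) * rho_cube
  have hco : IsCoprime ((x : 𝓞 K3) - rho ^ 2)
      (x ^ 2 + (rho ^ 2 - 2) * x + rho ^ 4 - 2 * rho ^ 2 + 1) := by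
    have h3 : (9 * rho ^ 2 - 2 * rho - 6) * (3 * rho ^ 4 - 4 * rho ^ 2 + 1) = (23 : 𝓞 K3) := by
      linear_combination (27 * rho ^ 3 - 6 * rho ^ 2 - 27 * rho + 29) * rho_cube
    have h8 : (3 * rho ^ 2 - rho - 2) * (3 * rho ^ 4 - 4 * rho ^ 2 + 1) = (8 : 𝓞 K3) - rho ^ 2 := by
      linear_combination (9 * rho ^ 3 - 3 * rho ^ 2 - 9 * rho + 10) * rho_cube
    refine ⟨n * (1 + (3 * rho ^ 2 - rho - 2) * (x + 2 * rho ^ 2 - 2))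
      - m * (9 * rho ^ 2 - 2 * rho - 6) * (x + 2 * rho ^ 2 - 2),
      m * (9 * rho ^ 2 - 2 * rho - 6) - n * (3 * rho ^ 2 - rho - 2), ?_⟩
    linear_combination hC + m * h3 - n * h8
  obtain ⟨d, u, hd⟩ := exists_associated_pow_of_mul_eq_pow' hco hfac
  obtain ⟨w, A, σ, hσ, hu⟩ := unit_mod_sq u
  rw [hu] at hd
  rcases hσ with rfl | rfl
  · exact ⟨d * w, A, by rw [← hd]; push_cast; ring⟩
  · exfalso
    obtain ⟨τ⟩ := K3_real
    have hτ := congrArg (fun z => τ (algebraMap (𝓞 K3) K3 z)) hd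
    simp only [map_mul, map_pow, map_sub, map_intCast] at hτ
    have hr : (τ (algebraMap (𝓞 K3) K3 rho)) ^ 3 = τ (algebraMap (𝓞 K3) K3 rho) + 1 := by
      rw [← map_pow, ← map_pow, rho_cube, map_add, map_add, map_one, map_one]
    generalize τ (algebraMap (𝓞 K3) K3 rho) = r at *
    generalize τ (algebraMap (𝓞 K3) K3 d) = d' at *
    generalize τ (algebraMap (𝓞 K3) K3 w) = w' at *
    obtain ⟨r1, r2⟩ := real_bounds hr
    have hxR : (2 : ℝ) ≤ x := by exact_mod_cast hx
    have hp : 0 ≤ d' ^ 2 * (r ^ (A : ℕ) * w' ^ 2) := by positivity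
    push_cast at hτ
    nlinarith

theorem case0 (x : ℤ) (g : 𝓞 K3) (h : (x : 𝓞 K3) - rho ^ 2 = g ^ 2) : False := by
  obtain ⟨u, v, w, rfl⟩ := exists_coord g
  rw [sq_coord] at h
  obtain ⟨-, h2, h3⟩ := coord_eq (a := x) (b := 0) (c := -1) (by rw [← h]; push_cast; ring)
  have hdec : ∀ u v w : ZMod 4, 0 = 2 * u * v + 2 * v * w + w ^ 2 →
    -1 ≠ v ^ 2 + 2 * u * w + w ^ 2 := by decide +kernel
  apply hdec u v w
  · exact_mod_cast congrArg (Int.cast : ℤ → ZMod 4) h2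
  · have := congrArg (Int.cast : ℤ → ZMod 4) h3
    push_cast at this
    exact this

theorem case1 (x : ℤ) (g : 𝓞 K3) (h : (x : 𝓞 K3) - rho ^ 2 = rho * g ^ 2) :
    ∃ p q w : ℤ, 0 < w ∧ p ^ 2 + q ^ 2 = w ^ 2 ∧ (p + q) ^ 2 + 1 = 2 * w * p ∧
      x = q ^ 2 - 2 * q * w + 2 * p * w := by
  obtain ⟨u, v, w, rfl⟩ := exists_coord g
  rw [sq_coord] at h
  obtain ⟨h1, h2, h3⟩ := coord_eq (a := x) (b := 0) (c := -1)
    (a' := v ^ 2 + 2 * u * w + w ^ 2) (b' := u ^ 2 + 2 * v * w + (v ^ 2 + 2 * u * w + w ^ 2))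
    (c' := 2 * u * v + 2 * v * w + w ^ 2)
    (by push_cast at h ⊢; linear_combination h + (v ^ 2 + 2 * u * w + w ^ 2) * rho_cube)
  have e1 : (u + w) ^ 2 + (v + w) ^ 2 = w ^ 2 := by linear_combination -h2
  have e2 : ((u + w) + (v + w)) ^ 2 + 1 = 2 * w * (u + w) := by
    linear_combination -h2 - h3
  have e3 : x = (v + w) ^ 2 - 2 * (v + w) * w + 2 * (u + w) * w := by linear_combination h1
  rcases lt_trichotomy w 0 with hw | hw | hw
  · exact ⟨-(u + w), -(v + w), -w, by omega, by linear_combination e1, by linear_combination e2,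
      by linear_combination e3⟩
  · exfalso
    rw [hw] at e2
    nlinarith [sq_nonneg (u + 0 + (v + 0))]
  · exact ⟨u + w, v + w, w, hw, e1, e2, e3⟩

theorem pyth (p q w : ℤ) (hw : 0 < w) (h1 : p ^ 2 + q ^ 2 = w ^ 2)
    (h2 : (p + q) ^ 2 + 1 = 2 * w * p) : q ^ 2 - 2 * q * w + 2 * p * w = 2 := by
  have hpq : Int.gcd p q = 1 := by
    rw [← Int.isCoprime_iff_gcd_eq_one]
    exact ⟨2 * w - p - 2 * q, -q, by linear_combination -h2⟩
  have hodd : p % 2 = 1 := by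
    have hdec : ∀ p q w : ZMod 4, p ^ 2 + q ^ 2 = w ^ 2 → (p + q) ^ 2 + 1 = 2 * w * p →
      2 * p = 2 := by decide +kernel
    have := hdec p q w (by exact_mod_cast congrArg (Int.cast : ℤ → ZMod 4) h1)
      (by exact_mod_cast congrArg (Int.cast : ℤ → ZMod 4) h2)
    have h' : ((2 * p : ℤ) : ZMod 4) = ((2 : ℤ) : ZMod 4) := by push_cast; exact this
    rw [ZMod.intCast_eq_intCast_iff_dvd_sub] at h'
    push_cast at h'
    omega
  obtain ⟨m, n, hp, hq, hz, -, -, -⟩ := PythagoreanTriple.coprime_classification'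
    (show PythagoreanTriple p q w by unfold PythagoreanTriple; linear_combination h1) hpq hodd hw
  obtain ⟨s, rfl⟩ : ∃ s, m = s + n := ⟨m - n, by ring⟩
  have hq4 : s ^ 4 - 8 * s ^ 2 * n ^ 2 - 8 * s * n ^ 3 - 4 * n ^ 4 = 1 := by
    rw [hp, hq, hz] at h2
    linear_combination -h2
  have hn : n % 2 = 0 := by
    have hdec : ∀ s n : ZMod 16, s ^ 4 - 8 * s ^ 2 * n ^ 2 - 8 * s * n ^ 3 - 4 * n ^ 4 = 1 →
      8 * n = 0 := by decide +kernel
    have := hdec s n (by exact_mod_cast congrArg (Int.cast : ℤ → ZMod 16) hq4)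
    have h' : ((8 * n : ℤ) : ZMod 16) = 0 := by push_cast; exact this
    rw [ZMod.intCast_zmod_eq_zero_iff_dvd] at h'
    push_cast at h'
    omega
  obtain ⟨k, rfl⟩ : ∃ k, n = 2 * k := ⟨n / 2, by omega⟩
  have hk := Q4.thue s k (by linear_combination hq4)
  subst hk
  have hs : s ^ 4 = 1 := by linear_combination hq4
  rw [hp, hq, hz]
  linear_combination 2 * hs

end Cub

theorem stmt_8 (t y : ℤ) :
    -y ^ 2 = t ^ 3 + 2 * t ^ 2 + t + 1 ↔ (t = -2 ∧ y = 1) ∨ (t = -2 ∧ y = -1) := by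
  constructor
  · intro h
    obtain ⟨x, rfl⟩ : ∃ x, t = -x := ⟨-t, by ring⟩
    have h' : y ^ 2 = x ^ 3 - 2 * x ^ 2 + x - 1 := by linear_combination -h
    have hx : 2 ≤ x := by
      by_contra hc
      have h1 : x ≤ 1 := by omega
      rcases eq_or_lt_of_le h1 with rfl | h2
      · nlinarith [sq_nonneg y]
      · nlinarith [sq_nonneg y, mul_nonneg (show 0 ≤ -x by omega) (sq_nonneg (x - 1))]
    have hx2 : x = 2 := by
      obtain ⟨g, A, hg⟩ := Cub.factor x y hx h'
      have hA : A = 0 ∨ A = 1 := by omega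
      rcases hA with rfl | rfl
      · exact (Cub.case0 x g (by simpa using hg)).elim
      · obtain ⟨p, q, w, hw, e1, e2, e3⟩ := Cub.case1 x g (by simpa using hg)
        rw [e3]
        exact Cub.pyth p q w hw e1 e2
    subst hx2
    have hy : y ^ 2 = 1 := by linear_combination h'
    rcases (sq_eq_sq_iff_eq_or_eq_neg.1 (hy.trans (one_pow 2).symm)) with rfl | rfl
    · left; exact ⟨rfl, rfl⟩
    · right; exact ⟨rfl, rfl⟩
  · rintro (⟨rfl, rfl⟩ | ⟨rfl, rfl⟩) <;> norm_num
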